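/- Let k be a field of characteristic not 2, K a field extension of k, and s ∈ K an element with s² = α for some α ∈ k but with s not in the image of k in K. Let n be odd. Then there is no matrix A ∈ Sp(2n,K) with A² = I such that every entry of A is a k-multiple of s (i.e. A_{i,j} = c_{i,j}·s with c_{i,j} in the image of k). In other words, Sp(2n,k) has no Type 2 involutions when n is odd. -/

import Mathlib

open Matrix

/-- The standard symplectic form matrix `J = [[0, Iₙ], [-Iₙ, 0]]`. -/
def SpJ (n : ℕ) (R : Type*) [CommRing R] : Matrix (Fin n ⊕ Fin n) (Fin n ⊕ Fin n) R :=
  Matrix.fromBlocks 0 1 (-1) 0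

/-- `M` belongs to the symplectic group `Sp(2n,R)`, i.e. `Mᵀ J M = J`. -/
def IsSymp {n : ℕ} {R : Type*} [CommRing R]
    (M : Matrix (Fin n ⊕ Fin n) (Fin n ⊕ Fin n) R) : Prop :=
  Mᵀ * SpJ n R * M = SpJ n R

open Polynomial in
/-- A square root of the scalar matrix `a`, where `a` is not a square, has characteristic
polynomial a power of `X ^ 2 - a`; hence in even dimension `2 * n` its determinant is
`(-a) ^ n`. -/
theorem Matrix.det_eq_neg_pow_of_mul_self_eq_smul_one {k m : Type*} [Field k] [Fintype m]
    [DecidableEq m] {n : ℕ} (hm : Fintype.card m = 2 * n) {a : k} (ha : ¬ IsSquare a)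
    {B : Matrix m m k} (hB : B * B = a • 1) : B.det = (-a) ^ n := by
  have hirr : Irreducible (X ^ 2 - C a : k[X]) :=
    X_pow_sub_C_irreducible_of_prime Nat.prime_two fun b hb => ha ⟨b, by rw [← hb, sq]⟩
  have hmonic : (X ^ 2 - C a : k[X]).Monic := monic_X_pow_sub_C a two_ne_zero
  have hdvd : B.charpoly ∣ (X ^ 2 - C a) ^ Fintype.card m := by
    refine ⟨(scalar m X + B.map C).det, ?_⟩
    rw [Matrix.charpoly, Matrix.charmatrix, ← det_mul]
    have hBC : B.map C * B.map C = (C a : k[X]) • (1 : Matrix m m k[X]) := by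
      rw [← Matrix.map_mul, hB]
      ext1 i j
      by_cases h : i = j <;> simp [h]
    have hfac : (scalar m (X : k[X]) - B.map C) * (scalar m X + B.map C) =
        (X ^ 2 - C a : k[X]) • (1 : Matrix m m k[X]) := by
      have hcomm := (scalar_commute (n := m) (X : k[X]) (fun r => Commute.all _ r) (B.map C)).eq
      rw [sub_mul, mul_add, mul_add, hBC, hcomm, ← map_mul, sub_smul, ← sq, scalar_apply,
        ← smul_one_eq_diagonal]
      abel
    rw [RingHom.mapMatrix_apply, hfac, det_smul, det_one, mul_one]
  obtain ⟨i, -, hi⟩ := (dvd_prime_pow hirr.prime _).1 hdvd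
  have hchar : B.charpoly = (X ^ 2 - C a) ^ i :=
    eq_of_monic_of_associated B.charpoly_monic (hmonic.pow i) hi
  have hdeg := congrArg natDegree hchar
  rw [charpoly_natDegree_eq_dim, natDegree_pow, natDegree_X_pow_sub_C, hm] at hdeg
  obtain rfl : n = i := by lia
  rw [det_eq_sign_charpoly_coeff, hchar, hm, coeff_zero_eq_eval_zero]
  simp

theorem IsSymp.det_eq_one {n : ℕ} {R : Type*} [CommRing R]
    {A : Matrix (Fin n ⊕ Fin n) (Fin n ⊕ Fin n) R} (hA : IsSymp A) : A.det = 1 := by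
  refine SymplecticGroup.det_eq_one (SymplecticGroup.mem_iff'.2 ?_)
  have hJ : J (Fin n) R = -SpJ n R := by simp [J, SpJ, fromBlocks_neg]
  rw [hJ, mul_neg, neg_mul, hA]

/-- When `n` is odd, `Sp(2n,k)` has no Type 2 involutions: there is no symplectic matrix
`A` over `K` with `A² = I` all of whose entries are `k`-multiples of `s = √α ∉ k`. -/
theorem stmt8 {k K : Type*} [Field k] [Field K] [Algebra k K]
    (hchar : (2 : k) ≠ 0) (s : K) (α : k) (hs : s ^ 2 = algebraMap k K α)
    (hsk : s ∉ Set.range (algebraMap k K)) {n : ℕ} (hn : Odd n) :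
    ¬ ∃ A : Matrix (Fin n ⊕ Fin n) (Fin n ⊕ Fin n) K, IsSymp A ∧ A * A = 1 ∧
        ∀ i j, ∃ c : k, A i j = algebraMap k K c * s := by
  rintro ⟨A, hA, hAA, hc⟩
  choose c hc using hc
  have hα : ¬ IsSquare α := by
    rintro ⟨b, rfl⟩
    rw [map_mul, ← sq, sq_eq_sq_iff_eq_or_eq_neg] at hs
    rcases hs with h | h
    · exact hsk ⟨b, h.symm⟩
    · exact hsk ⟨-b, by rw [map_neg, h]⟩
  have hα0 : α ≠ 0 := by
    rintro rfl
    exact hα IsSquare.zero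
  have hmap : (algebraMap k K).mapMatrix (α • of c) = s • A := by
    ext i j
    simp only [RingHom.mapMatrix_apply, map_apply, Matrix.smul_apply, of_apply, smul_eq_mul, map_mul, hc,
      ← hs]
    ring
  have hsq : (α • of c) * (α • of c) = α • (1 : Matrix (Fin n ⊕ Fin n) (Fin n ⊕ Fin n) k) := by
    refine Matrix.map_injective (algebraMap k K).injective ?_
    change (algebraMap k K).mapMatrix _ = (algebraMap k K).mapMatrix _
    rw [map_mul, hmap, smul_mul_smul_comm, hAA, ← sq, hs]
    ext i j
    by_cases h : i = j <;> simp [h]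
  have hcard : Fintype.card (Fin n ⊕ Fin n) = 2 * n := by simp [two_mul]
  have hdet := congrArg det hmap
  rw [← RingHom.map_det, Matrix.det_eq_neg_pow_of_mul_self_eq_smul_one hcard hα hsq, det_smul,
    hA.det_eq_one, mul_one, hcard, pow_mul, hs, ← map_pow] at hdet
  have hneg := (algebraMap k K).injective hdet
  rw [hn.neg_pow, neg_eq_iff_add_eq_zero, ← two_mul] at hneg
  exact mul_ne_zero hchar (pow_ne_zero n hα0) hneg
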